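/- Fix β ∈ ℝ and 0 < λ₋ < λ₊. For each m ≥ 2 let D(λ₋,λ₊,m) be the set of m×m diagonal matrices with nondecreasing diagonal entries λ₋ = λ_1 ≤ … ≤ λ_m = λ₊, and set λ₋(m,β) := min{Λ(A,β) : A ∈ D(λ₋,λ₊,m)} and λ₊(m,β) := max{Λ(A,β) : A ∈ D(λ₋,λ₊,m)}. Then λ₋(m,β) → λ₋ and λ₊(m,β) → λ₊ as m → ∞. -/

import Mathlib

open MeasureTheory Metric Filter
open scoped InnerProductSpace RealInnerProductSpace ENNReal NNReal

noncomputable section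

/-- The uniform (normalized rotation-invariant) probability measure on the unit sphere
`S^{m-1}` of Euclidean `ℝ^m`, obtained by normalizing the canonical sphere measure induced
by the Lebesgue (Haar) measure. -/
def sphereUniform (m : ℕ) : Measure (sphere (0 : EuclideanSpace ℝ (Fin m)) 1) :=
  (((volume : Measure (EuclideanSpace ℝ (Fin m))).toSphere) Set.univ)⁻¹ •
    ((volume : Measure (EuclideanSpace ℝ (Fin m))).toSphere)

/-- The quadratic form `θ ↦ ⟨θ, A θ⟩` associated to a matrix `A`. -/
def quadForm {m : ℕ} (A : Matrix (Fin m) (Fin m) ℝ) (θ : EuclideanSpace ℝ (Fin m)) : ℝ :=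
  ⟪θ, Matrix.toEuclideanLin A θ⟫_ℝ

/-- `Z(A,s) := ∫_{S^{m-1}} ⟨θ,Aθ⟩^{-s} dσ(θ)`. -/
def Zfun {m : ℕ} (A : Matrix (Fin m) (Fin m) ℝ) (s : ℝ) : ℝ :=
  ∫ θ : sphere (0 : EuclideanSpace ℝ (Fin m)) 1, quadForm A ↑θ ^ (-s) ∂(sphereUniform m)

/-- The `β`-average eigenvalue `Λ(A,β) := Z(A,β)/Z(A,1+β)`. -/
def lambdaAvg {m : ℕ} (A : Matrix (Fin m) (Fin m) ℝ) (β : ℝ) : ℝ :=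
  Zfun A β / Zfun A (1 + β)

/-- The probability measure `μ_{A,β}` on `S^{m-1}` with density
`θ ↦ ⟨θ,Aθ⟩^{-1-β}/Z(A,1+β)` with respect to the uniform measure `σ`. -/
def muAB {m : ℕ} (A : Matrix (Fin m) (Fin m) ℝ) (β : ℝ) :
    Measure (sphere (0 : EuclideanSpace ℝ (Fin m)) 1) :=
  (sphereUniform m).withDensity fun θ =>
    ENNReal.ofReal (quadForm A ↑θ ^ (-(1 + β)) / Zfun A (1 + β))

/-- The set `D(λ₋,λ₊,m)` of `m×m` diagonal matrices (`m = n + 2 ≥ 2`) with nondecreasing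
diagonal entries going from `λ₋` to `λ₊`. -/
def Dset (lamm lamp : ℝ) (n : ℕ) : Set (Matrix (Fin (n + 2)) (Fin (n + 2)) ℝ) :=
  {A | (∀ i j, i ≠ j → A i j = 0) ∧ Monotone (fun i => A i i) ∧
    A 0 0 = lamm ∧ A (Fin.last (n + 1)) (Fin.last (n + 1)) = lamp}

section helpers
open scoped Pointwise

instance sphereUniform_prob (n : ℕ) : IsProbabilityMeasure (sphereUniform (n + 2)) := by
  constructor
  unfold sphereUniform
  rw [Measure.smul_apply, smul_eq_mul]
  refine ENNReal.inv_mul_cancel ?_ (measure_ne_top _ _)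
  rw [Ne, Measure.measure_univ_eq_zero]
  exact Measure.toSphere_ne_zero _

lemma rpow_bounds (a b : ℝ) (ha : 0 < a) (hab : a ≤ b) (s : ℝ) :
    ∃ l u : ℝ, 0 < l ∧ 0 < u ∧ ∀ x, a ≤ x → x ≤ b → l ≤ x ^ s ∧ x ^ s ≤ u := by
  have hb : 0 < b := ha.trans_le hab
  rcases le_total 0 s with hs | hs
  · refine ⟨a ^ s, b ^ s, by positivity, by positivity, fun x h1 h2 => ⟨?_, ?_⟩⟩
    · exact Real.rpow_le_rpow ha.le h1 hs
    · exact Real.rpow_le_rpow (ha.le.trans h1) h2 hs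
  · refine ⟨b ^ s, a ^ s, by positivity, by positivity, fun x h1 h2 => ⟨?_, ?_⟩⟩
    · exact Real.rpow_le_rpow_of_nonpos (ha.trans_le h1) h2 hs
    · exact Real.rpow_le_rpow_of_nonpos ha h1 hs

lemma ratio_bound {X : Type*} [TopologicalSpace X] [CompactSpace X] [MeasurableSpace X]
    [BorelSpace X] (σ : Measure X) [IsProbabilityMeasure σ] (Q : X → ℝ) (hQ : Continuous Q)
    (a b : ℝ) (ha : 0 < a) (hQa : ∀ x, a ≤ Q x) (hQb : ∀ x, Q x ≤ b) (β l u : ℝ) (hl : 0 < l)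
    (hlu : ∀ x, a ≤ x → x ≤ b → l ≤ x ^ (-(1 + β)) ∧ x ^ (-(1 + β)) ≤ u) :
    (a ≤ (∫ x, Q x ^ (-β) ∂σ) / (∫ x, Q x ^ (-(1 + β)) ∂σ)) ∧
    ((∫ x, Q x ^ (-β) ∂σ) / (∫ x, Q x ^ (-(1 + β)) ∂σ) ≤ b) ∧
    ∀ c, |(∫ x, Q x ^ (-β) ∂σ) / (∫ x, Q x ^ (-(1 + β)) ∂σ) - c| ≤
      u / l * ∫ x, |Q x - c| ∂σ := by
  have hpos : ∀ x, 0 < Q x := fun x => ha.trans_le (hQa x)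
  set W : X → ℝ := fun x => Q x ^ (-(1 + β)) with hW
  have hWc : Continuous W := hQ.rpow_const (fun x => Or.inl (hpos x).ne')
  have int : ∀ f : X → ℝ, Continuous f → Integrable f σ := fun f hf =>
    hf.integrable_of_hasCompactSupport (HasCompactSupport.of_compactSpace f)
  have hWl : ∀ x, l ≤ W x := fun x => (hlu _ (hQa x) (hQb x)).1
  have hWu : ∀ x, W x ≤ u := fun x => (hlu _ (hQa x) (hQb x)).2
  have hWpos : ∀ x, 0 < W x := fun x => hl.trans_le (hWl x)
  have e : ∀ x, Q x ^ (-β) = Q x * W x := by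
    intro x
    have : -β = 1 + -(1 + β) := by ring
    rw [this, Real.rpow_add (hpos x), Real.rpow_one]
  simp_rw [e]
  have hZ : l ≤ ∫ x, W x ∂σ := by
    have := integral_mono (integrable_const l) (int W hWc) hWl
    simpa using this
  have hZp : 0 < ∫ x, W x ∂σ := hl.trans_le hZ
  refine ⟨?_, ?_, fun c => ?_⟩
  · rw [le_div_iff₀ hZp, ← integral_const_mul]
    exact integral_mono (int _ (hWc.const_mul a)) (int _ (hQ.mul hWc))
      (fun x => mul_le_mul_of_nonneg_right (hQa x) (hWpos x).le)
  · rw [div_le_iff₀ hZp, ← integral_const_mul]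
    exact integral_mono (int _ (hQ.mul hWc)) (int _ (hWc.const_mul b))
      (fun x => mul_le_mul_of_nonneg_right (hQb x) (hWpos x).le)
  · have h1 : (∫ x, Q x * W x ∂σ) / (∫ x, W x ∂σ) - c =
        (∫ x, (Q x - c) * W x ∂σ) / ∫ x, W x ∂σ := by
      have : ∫ x, (Q x - c) * W x ∂σ = (∫ x, Q x * W x ∂σ) - c * ∫ x, W x ∂σ := by
        rw [← integral_const_mul, ← integral_sub (int (fun x => Q x * W x) (hQ.mul hWc)) (int _ (hWc.const_mul c))]
        simp_rw [sub_mul]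
      rw [this]
      field_simp
    have hac : Continuous (fun x => |Q x - c|) := (hQ.sub continuous_const).abs
    have h2 : |∫ x, (Q x - c) * W x ∂σ| ≤ u * ∫ x, |Q x - c| ∂σ := by
      refine (abs_integral_le_integral_abs).trans ?_
      rw [← integral_const_mul]
      refine integral_mono (int _ ((hQ.sub continuous_const).mul hWc).abs)
        (int _ (hac.const_mul u)) (fun x => ?_)
      simp only [abs_mul, abs_of_pos (hWpos x)]
      rw [mul_comm]
      exact mul_le_mul_of_nonneg_right (hWu x) (abs_nonneg _)
    rw [h1, abs_div, abs_of_pos hZp, div_mul_eq_mul_div]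
    exact div_le_div₀ ((abs_nonneg _).trans h2) h2 hl hZ

lemma quadForm_diag {m : ℕ} (A : Matrix (Fin m) (Fin m) ℝ) (hA : ∀ i j, i ≠ j → A i j = 0)
    (θ : EuclideanSpace ℝ (Fin m)) : quadForm A θ = ∑ i, A i i * θ i ^ 2 := by
  unfold quadForm
  simp only [PiLp.inner_apply, Matrix.ofLp_toEuclideanLin_apply, Matrix.mulVec, dotProduct]
  refine Finset.sum_congr rfl fun i _ => ?_
  rw [Finset.sum_eq_single i (fun j _ hj => by rw [hA i j hj.symm, zero_mul]) (by simp)]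
  simp
  ring

lemma sphere_sum {m : ℕ} (θ : sphere (0 : EuclideanSpace ℝ (Fin m)) 1) :
    ∑ i, (θ : EuclideanSpace ℝ (Fin m)) i ^ 2 = 1 := by
  rw [← EuclideanSpace.real_norm_sq_eq]
  simp

/-- coordinate permutation, acting on the sphere -/
def sphMap {m : ℕ} (L : EuclideanSpace ℝ (Fin m) ≃ₗᵢ[ℝ] EuclideanSpace ℝ (Fin m))
    (θ : sphere (0 : EuclideanSpace ℝ (Fin m)) 1) : sphere (0 : EuclideanSpace ℝ (Fin m)) 1 :=
  ⟨L θ, by simp⟩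

lemma sphMap_continuous {m : ℕ}
    (L : EuclideanSpace ℝ (Fin m) ≃ₗᵢ[ℝ] EuclideanSpace ℝ (Fin m)) :
    Continuous (sphMap L) :=
  Continuous.subtype_mk (L.continuous.comp continuous_subtype_val) _

lemma sphMap_mp {m : ℕ} (L : EuclideanSpace ℝ (Fin m) ≃ₗᵢ[ℝ] EuclideanSpace ℝ (Fin m)) :
    MeasurePreserving (sphMap L) (sphereUniform m) (sphereUniform m) := by
  have key : MeasurePreserving (sphMap L)
      ((volume : Measure (EuclideanSpace ℝ (Fin m))).toSphere)
      ((volume : Measure (EuclideanSpace ℝ (Fin m))).toSphere) := by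
    refine ⟨(sphMap_continuous L).measurable, ?_⟩
    ext s hs
    rw [Measure.map_apply (sphMap_continuous L).measurable hs,
      Measure.toSphere_apply' _ ((sphMap_continuous L).measurable hs),
      Measure.toSphere_apply' _ hs]
    congr 1
    have : Set.Ioo (0 : ℝ) 1 • (((↑) : sphere (0 : EuclideanSpace ℝ (Fin m)) 1 → _) ''
        (sphMap L ⁻¹' s)) = L ⁻¹' (Set.Ioo (0 : ℝ) 1 •
          (((↑) : sphere (0 : EuclideanSpace ℝ (Fin m)) 1 → _) '' s)) := by
      ext x
      simp only [Set.mem_smul, Set.mem_preimage, Set.mem_image]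
      constructor
      · rintro ⟨r, hr, y, ⟨θ, hθ, rfl⟩, rfl⟩
        exact ⟨r, hr, _, ⟨_, hθ, rfl⟩, by simp [sphMap]⟩
      · rintro ⟨r, hr, y, ⟨θ, hθ, rfl⟩, h⟩
        refine ⟨r, hr, _, ⟨sphMap L.symm θ, ?_, rfl⟩, ?_⟩
        · convert hθ
          ext1
          simp [sphMap]
        · apply L.injective
          simp [sphMap, h]
    rw [this]
    exact L.measurePreserving.measure_preimage_emb L.toHomeomorph.measurableEmbedding _
  unfold sphereUniform
  exact key.smul_measure _

lemma coord_cont {m : ℕ} (i : Fin m) :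
    Continuous (fun θ : sphere (0 : EuclideanSpace ℝ (Fin m)) 1 =>
      (θ : EuclideanSpace ℝ (Fin m)) i ^ 2) := by
  fun_prop

lemma coord_eq {m : ℕ} (i j : Fin m) :
    ∫ θ, (θ : EuclideanSpace ℝ (Fin m)) i ^ 2 ∂(sphereUniform m) =
    ∫ θ, (θ : EuclideanSpace ℝ (Fin m)) j ^ 2 ∂(sphereUniform m) := by
  have L := (sphMap_mp (LinearIsometryEquiv.piLpCongrLeft 2 ℝ ℝ (Equiv.swap i j)))
  conv_rhs => rw [← L.map_eq]
  rw [integral_map L.measurable.aemeasurable (coord_cont j).aestronglyMeasurable]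
  simp [sphMap, LinearIsometryEquiv.piLpCongrLeft_apply]

lemma coord_int (n : ℕ) (i : Fin (n + 2)) :
    ∫ θ, (θ : EuclideanSpace ℝ (Fin (n + 2))) i ^ 2 ∂(sphereUniform (n + 2)) =
      1 / ((n : ℝ) + 2) := by
  have h : ∑ j, ∫ θ, (θ : EuclideanSpace ℝ (Fin (n + 2))) j ^ 2 ∂(sphereUniform (n + 2)) = 1 := by
    rw [← integral_finsetSum]
    · simp_rw [sphere_sum]
      simp
    · intro j _
      exact (coord_cont j).integrable_of_hasCompactSupport (HasCompactSupport.of_compactSpace _)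
  rw [Finset.sum_congr rfl (fun j _ => coord_eq j i)] at h
  simp at h
  rw [eq_div_iff (by positivity), mul_comm]
  exact h

lemma quad_cont {m : ℕ} (A : Matrix (Fin m) (Fin m) ℝ) :
    Continuous (fun θ : sphere (0 : EuclideanSpace ℝ (Fin m)) 1 =>
      quadForm A (θ : EuclideanSpace ℝ (Fin m))) := by
  unfold quadForm
  have : Continuous (Matrix.toEuclideanLin A) := LinearMap.continuous_of_finiteDimensional _
  fun_prop

lemma main_bound (β a b : ℝ) (ha : 0 < a) (hab : a ≤ b) : ∃ K : ℝ, 0 ≤ K ∧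
    ∀ n, ∀ A ∈ Dset a b n, a ≤ lambdaAvg A β ∧ lambdaAvg A β ≤ b ∧
      ∀ c, |lambdaAvg A β - c| ≤ K * ∫ θ, |∑ i, (A i i - c) *
        (θ : EuclideanSpace ℝ (Fin (n + 2))) i ^ 2| ∂(sphereUniform (n + 2)) := by
  obtain ⟨l, u, hl, hu, hlu⟩ := rpow_bounds a b ha hab (-(1 + β))
  refine ⟨u / l, by positivity, ?_⟩
  rintro n A ⟨hA, hmono, hA0, hA1⟩
  have hi : ∀ i, a ≤ A i i ∧ A i i ≤ b := fun i =>
    ⟨hA0 ▸ hmono (Fin.zero_le i), hA1 ▸ hmono (Fin.le_last i)⟩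
  have hsub : ∀ (c : ℝ) (θ : sphere (0 : EuclideanSpace ℝ (Fin (n + 2))) 1),
      quadForm A θ - c = ∑ i, (A i i - c) * (θ : EuclideanSpace ℝ (Fin (n + 2))) i ^ 2 := by
    intro c θ
    simp_rw [sub_mul, Finset.sum_sub_distrib, ← Finset.mul_sum, sphere_sum, quadForm_diag A hA]
    ring
  have hQa : ∀ θ : sphere (0 : EuclideanSpace ℝ (Fin (n + 2))) 1, a ≤ quadForm A θ := by
    intro θ
    rw [← sub_nonneg, hsub]
    exact Finset.sum_nonneg fun i _ => mul_nonneg (sub_nonneg.2 (hi i).1) (sq_nonneg _)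
  have hQb : ∀ θ : sphere (0 : EuclideanSpace ℝ (Fin (n + 2))) 1, quadForm A θ ≤ b := by
    intro θ
    rw [← sub_nonpos, hsub]
    exact Finset.sum_nonpos fun i _ =>
      mul_nonpos_of_nonpos_of_nonneg (sub_nonpos.2 (hi i).2) (sq_nonneg _)
  have := ratio_bound (sphereUniform (n + 2)) (fun θ => quadForm A θ) (quad_cont A) a b ha hQa hQb
    β l u hl hlu
  simp_rw [hsub] at this
  exact this

lemma special_bound (β a b : ℝ) (ha : 0 < a) (hab : a ≤ b) : ∃ K : ℝ,
    ∀ n, ∀ A ∈ Dset a b n, ∀ (c d : ℝ) (i₀ : Fin (n + 2)), (∀ i, i ≠ i₀ → A i i = c) →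
      A i₀ i₀ = d → |lambdaAvg A β - c| ≤ K * |d - c| / ((n : ℝ) + 2) := by
  obtain ⟨K, -, h⟩ := main_bound β a b ha hab
  refine ⟨K, fun n A hA c d i₀ hc hd => ?_⟩
  refine ((h n A hA).2.2 c).trans_eq ?_
  have : ∀ θ : sphere (0 : EuclideanSpace ℝ (Fin (n + 2))) 1,
      |∑ i, (A i i - c) * (θ : EuclideanSpace ℝ (Fin (n + 2))) i ^ 2| =
        |d - c| * (θ : EuclideanSpace ℝ (Fin (n + 2))) i₀ ^ 2 := by
    intro θ
    rw [Finset.sum_eq_single i₀ (fun i _ hi => by rw [hc i hi]; ring) (by simp), hd, abs_mul,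
      abs_of_nonneg (sq_nonneg ((θ : EuclideanSpace ℝ (Fin (n + 2))) i₀))]
  simp_rw [this]
  rw [integral_const_mul, coord_int]
  ring

end helpers

/-- fix `β ∈ ℝ` and `0 < λ₋ < λ₊`; with
`λ₋(m,β) = min{Λ(A,β) : A ∈ D(λ₋,λ₊,m)}` and `λ₊(m,β) = max{Λ(A,β) : A ∈ D(λ₋,λ₊,m)}`,
one has `λ₋(m,β) → λ₋` and `λ₊(m,β) → λ₊` as `m → ∞` (here `m = n + 2` ranges over all
integers `≥ 2`). -/
theorem statement18 (β lamm lamp : ℝ) (h0 : 0 < lamm) (h1 : lamm < lamp) :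
    Tendsto (fun n : ℕ => sInf ((fun A => lambdaAvg A β) '' Dset lamm lamp n))
        atTop (nhds lamm) ∧
      Tendsto (fun n : ℕ => sSup ((fun A => lambdaAvg A β) '' Dset lamm lamp n))
        atTop (nhds lamp) := by
  obtain ⟨_, -, hb⟩ := main_bound β lamm lamp h0 h1.le
  obtain ⟨K, hK⟩ := special_bound β lamm lamp h0 h1.le
  have hlow : ∀ n, Matrix.diagonal (fun i : Fin (n + 2) =>
      if i = Fin.last (n + 1) then lamp else lamm) ∈ Dset lamm lamp n := by
    intro n
    refine ⟨fun i j h => Matrix.diagonal_apply_ne _ h, ?_, ?_, ?_⟩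
    · intro i j hij
      simp only [Matrix.diagonal_apply_eq]
      split_ifs with p q
      · exact le_rfl
      · exact absurd (Fin.last_le_iff.1 (p ▸ hij)) q
      · exact h1.le
      · exact le_rfl
    · rw [Matrix.diagonal_apply_eq, if_neg (by simp [Fin.ext_iff])]
    · simp
  have hhigh : ∀ n, Matrix.diagonal (fun i : Fin (n + 2) =>
      if i = 0 then lamm else lamp) ∈ Dset lamm lamp n := by
    intro n
    refine ⟨fun i j h => Matrix.diagonal_apply_ne _ h, ?_, ?_, ?_⟩
    · intro i j hij
      simp only [Matrix.diagonal_apply_eq]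
      split_ifs with p q q
      · exact le_rfl
      · exact h1.le
      · exact absurd (Fin.le_zero_iff.1 (q ▸ hij)) p
      · exact le_rfl
    · simp
    · rw [Matrix.diagonal_apply_eq, if_neg (by simp [Fin.ext_iff])]
  have hlim : ∀ C : ℝ, Tendsto (fun n : ℕ => C / ((n : ℝ) + 2)) atTop (nhds 0) := fun C =>
    Tendsto.div_atTop tendsto_const_nhds
      (tendsto_atTop_add_const_right _ _ tendsto_natCast_atTop_atTop)
  constructor
  · have hup : Tendsto (fun n : ℕ => lamm + K * |lamp - lamm| / ((n : ℝ) + 2)) atTop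
        (nhds lamm) := by
      simpa using (hlim (K * |lamp - lamm|)).const_add lamm
    refine tendsto_of_tendsto_of_tendsto_of_le_of_le tendsto_const_nhds hup (fun n => ?_)
      (fun n => ?_)
    · refine le_csInf ⟨_, _, hlow n, rfl⟩ ?_
      rintro _ ⟨A, hA, rfl⟩
      exact (hb n A hA).1
    · have hbd : BddBelow ((fun A => lambdaAvg A β) '' Dset lamm lamp n) := by
        refine ⟨lamm, ?_⟩
        rintro _ ⟨A, hA, rfl⟩
        exact (hb n A hA).1
      refine (csInf_le hbd (Set.mem_image_of_mem _ (hlow n))).trans ?_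
      have := hK n _ (hlow n) lamm lamp (Fin.last (n + 1)) (fun i hi => by simp [hi]) (by simp)
      have := (abs_le.1 this).2
      linarith
  · have hup : Tendsto (fun n : ℕ => lamp - K * |lamm - lamp| / ((n : ℝ) + 2)) atTop
        (nhds lamp) := by
      simpa using (hlim (K * |lamm - lamp|)).const_sub lamp
    refine tendsto_of_tendsto_of_tendsto_of_le_of_le hup tendsto_const_nhds (fun n => ?_)
      (fun n => ?_)
    · have hbd : BddAbove ((fun A => lambdaAvg A β) '' Dset lamm lamp n) := by
        refine ⟨lamp, ?_⟩
        rintro _ ⟨A, hA, rfl⟩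
        exact (hb n A hA).2.1
      refine le_trans ?_ (le_csSup hbd (Set.mem_image_of_mem _ (hhigh n)))
      have := hK n _ (hhigh n) lamp lamm 0 (fun i hi => by simp [hi]) (by simp)
      have := (abs_le.1 this).1
      linarith
    · refine csSup_le ⟨_, _, hhigh n, rfl⟩ ?_
      rintro _ ⟨A, hA, rfl⟩
      exact (hb n A hA).2.1
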